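/- Let M be a consistent finite functional causal model on a directed graph G = (V,E), i.e., with average number of solutions N̄ > 0, and let its distribution be P(x)_G = (Σ_u Π_{v∈V} p^v(u_v) δ_{x_v, f^v(x_{pa(v)}, u_v)}) / N̄. Then M is probabilistically Markovian, i.e., P(x)_G = Π_{v∈V} P^(v)(x_v | x_{pa(v)}) for all joint assignments x, if and only if M is averagely uniquely solvable, i.e., N̄ = 1. -/

import Mathlib

open Finset

noncomputable section

/-- The Kronecker delta `δ_{x,y}` as a real number: `1` if `x = y` and `0` otherwise. -/
def kron {α : Type*} (x y : α) : ℝ := by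
  classical exact if x = y then 1 else 0

/-- A finite functional causal model (fCM) on a directed graph `G = (V, E)` with finite
vertex set: each vertex `v` carries a nonempty finite set `X v` of values, a finite set
`U v` of error values with a probability distribution `pU v`, and a function
`f v : X_{pa(v)} × U_v → X_v` (the dependence on the parents `pa(v) = {w : E w v}` is
encoded by giving `f v` access to the values of all `w` with `E w v`). -/
structure FCM (V : Type) [Fintype V] [DecidableEq V] (E : V → V → Prop) where
  X : V → Type
  fintX : ∀ v, Fintype (X v)
  neX : ∀ v, Nonempty (X v)
  U : V → Type
  fintU : ∀ v, Fintype (U v)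
  pU : ∀ v, U v → ℝ
  pU_mem : ∀ v u, 0 ≤ pU v u ∧ pU v u ≤ 1
  pU_sum : ∀ v, letI := fintU v; (∑ u, pU v u) = 1
  f : ∀ v, (∀ w, E w v → X w) → U v → X v

attribute [instance] FCM.fintX FCM.neX FCM.fintU

variable {V : Type} [Fintype V] [DecidableEq V] {E : V → V → Prop}

/-- The number of solutions `N(u)` of an fCM for a valuation `u` of the error variables. -/
def FCM.Nsol (M : FCM V E) (u : ∀ v, M.U v) : ℝ :=
  ∑ x : ∀ v, M.X v, ∏ v, kron (M.f v (fun w _ => x w) (u v)) (x v)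

/-- The average number of solutions `N̄ = Σ_u N(u) Π_v p^v(u_v)` of an fCM. -/
def FCM.Nbar (M : FCM V E) : ℝ :=
  ∑ u : ∀ v, M.U v, M.Nsol u * ∏ v, M.pU v (u v)

/-- The (unnormalized) weight `Σ_u Π_v p^v(u_v) δ_{x_v, f^v(x_{pa(v)}, u_v)}` of a joint
assignment `x`. -/
def FCM.numer (M : FCM V E) (x : ∀ v, M.X v) : ℝ :=
  ∑ u : ∀ v, M.U v, ∏ v, M.pU v (u v) * kron (x v) (M.f v (fun w _ => x w) (u v))

/-- The distribution of a consistent fCM: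
`P(x)_G = (Σ_u Π_v p^v(u_v) δ_{x_v, f^v(x_{pa(v)}, u_v)}) / N̄`. -/
def FCM.Pdist (M : FCM V E) (x : ∀ v, M.X v) : ℝ :=
  M.numer x / M.Nbar

/-- The conditional probability `P^(v)(x_v | x_{pa(v)}) = Σ_{u_v} p^v(u_v) δ_{x_v, f^v(x_{pa(v)}, u_v)}`
associated to the vertex `v`. -/
def FCM.condPv (M : FCM V E) (v : V) (x : ∀ w, M.X w) : ℝ :=
  ∑ u : M.U v, M.pU v u * kron (x v) (M.f v (fun w _ => x w) u)

theorem kron_comm {α : Type*} (x y : α) : kron x y = kron y x := by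
  unfold kron
  classical exact if_congr eq_comm rfl rfl

/-- The weight of a joint assignment factorizes into the conditional probabilities. -/
theorem FCM.numer_eq_prod_condPv (M : FCM V E) (x : ∀ v, M.X v) :
    M.numer x = ∏ v, M.condPv v x := by
  simp only [FCM.numer, FCM.condPv, Fintype.prod_sum]

/-- The weights of all joint assignments add up to the average number of solutions. -/
theorem FCM.sum_numer (M : FCM V E) : ∑ x, M.numer x = M.Nbar := by
  simp only [FCM.numer, FCM.Nbar, FCM.Nsol, Finset.sum_mul]
  rw [Finset.sum_comm]
  refine Finset.sum_congr rfl fun u _ => Finset.sum_congr rfl fun x _ => ?_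
  rw [Finset.prod_mul_distrib, mul_comm]
  simp only [kron_comm (x _)]

/-- A consistent finite functional causal model (one with average number
of solutions `N̄ > 0`), with distribution `P(x) = (Σ_u Π_v p^v(u_v) δ_{x_v, f^v(...)}) / N̄`,
is probabilistically Markovian — i.e. `P(x) = Π_v P^(v)(x_v | x_{pa(v)})` for all joint
assignments `x` — if and only if it is averagely uniquely solvable, i.e. `N̄ = 1`. -/
theorem markov_iff_averagely_uniquely_solvable
    (M : FCM V E) (hcons : 0 < M.Nbar) :
    (∀ x : ∀ v, M.X v, M.Pdist x = ∏ v, M.condPv v x) ↔ M.Nbar = 1 := by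
  simp only [← M.numer_eq_prod_condPv, FCM.Pdist]
  constructor
  · intro h
    rw [← M.sum_numer, ← Finset.sum_congr rfl fun x _ => h x, ← Finset.sum_div, M.sum_numer,
      div_self hcons.ne']
  · intro h x
    rw [h, div_one]
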